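/- Every 2-local automorphism of the algebra S₂ is an automorphism (in particular, it is linear and bijective). -/

import Mathlib

set_option maxSynthPendingDepth 3

/-- The 2-dimensional vector space `V₂ = F²`, with standard basis `v₁ = (1,0)`, `v₂ = (0,1)`. -/
abbrev V2 (F : Type*) [Field F] := Fin 2 → F

/-- The fixed vector `v₁` (the first standard basis vector of `V₂`). -/
noncomputable def v1 (F : Type*) [Field F] : V2 F := Pi.single 0 1

/-- `W(2)`: the space of all bilinear multiplications on `V₂`. -/
abbrev Wtwo (F : Type*) [Field F] := V2 F →ₗ[F] V2 F →ₗ[F] V2 F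

variable {F : Type*} [Field F]

/-- The Kantor product on `W(2)`:
`(A·B)(x,y) = A(v₁, B(x,y)) − B(A(v₁,x), y) − B(x, A(v₁,y))`. -/
noncomputable def wmul (A B : Wtwo F) : Wtwo F :=
  LinearMap.mk₂ F
    (fun x y => A (v1 F) (B x y) - B (A (v1 F) x) y - B x (A (v1 F) y))
    (fun x x' y => by simp only [map_add, LinearMap.add_apply]; abel)
    (fun c x y => by simp only [map_smul, LinearMap.smul_apply, smul_sub])
    (fun x y y' => by simp only [map_add, LinearMap.add_apply]; abel)
    (fun c x y => by simp only [map_smul, LinearMap.smul_apply, smul_sub])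

/-- The multiplication `α^k_{i,j}` determined by `α^k_{i,j}(v_t, v_l) = δ_{it} δ_{jl} v_k`
(indices `0, 1` correspond to `1, 2` in the paper). -/
noncomputable def alph (k i j : Fin 2) : Wtwo F :=
  LinearMap.mk₂ F
    (fun x y => (x i * y j) • (Pi.single k 1 : V2 F))
    (fun x x' y => by simp [add_mul, add_smul])
    (fun c x y => by simp [smul_smul, mul_assoc])
    (fun x y y' => by simp [mul_add, add_smul])
    (fun c x y => by simp [smul_smul]; ring_nf)

noncomputable def e1 (F : Type*) [Field F] : Wtwo F := alph 0 0 0 - alph 1 0 1 - alph 1 1 0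

noncomputable def e2 (F : Type*) [Field F] : Wtwo F := alph 1 0 0

noncomputable def e3 (F : Type*) [Field F] : Wtwo F := alph 1 1 1 - alph 0 0 1 - alph 0 1 0

noncomputable def e4 (F : Type*) [Field F] : Wtwo F := alph 0 1 1


theorem wmul_add_left (A A' B : Wtwo F) : wmul (A + A') B = wmul A B + wmul A' B := by
  apply LinearMap.ext; intro x; apply LinearMap.ext; intro y
  simp [wmul]; abel

theorem wmul_smul_left (c : F) (A B : Wtwo F) : wmul (c • A) B = c • wmul A B := by
  apply LinearMap.ext; intro x; apply LinearMap.ext; intro y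
  simp [wmul, smul_sub]

theorem wmul_add_right (A B B' : Wtwo F) : wmul A (B + B') = wmul A B + wmul A B' := by
  apply LinearMap.ext; intro x; apply LinearMap.ext; intro y
  simp [wmul]; abel

theorem wmul_smul_right (c : F) (A B : Wtwo F) : wmul A (c • B) = c • wmul A B := by
  apply LinearMap.ext; intro x; apply LinearMap.ext; intro y
  simp [wmul, smul_sub]

theorem wmul_sub_left (A A' B : Wtwo F) : wmul (A - A') B = wmul A B - wmul A' B := by
  apply LinearMap.ext; intro x; apply LinearMap.ext; intro y
  simp [wmul]; abel

theorem wmul_sub_right (A B B' : Wtwo F) : wmul A (B - B') = wmul A B - wmul A B' := by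
  apply LinearMap.ext; intro x; apply LinearMap.ext; intro y
  simp [wmul]; abel

theorem wmul_alph (k i j k' i' j' : Fin 2) :
    wmul (alph k i j) (alph k' i' j' : Wtwo F) =
      (if i = 0 then (1:F) else 0) •
        ((if j = k' then (1:F) else 0) • alph k i' j'
          - (if k = i' then (1:F) else 0) • alph k' j j'
          - (if k = j' then (1:F) else 0) • alph k' i' j) := by
  apply LinearMap.ext; intro x; apply LinearMap.ext; intro y
  funext m
  simp [wmul, alph, v1, Pi.single_apply]
  split_ifs <;> simp_all <;> try ring

theorem mul_e4_left (B : Wtwo F) : wmul (e4 F) B = 0 := by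
  apply LinearMap.ext; intro x; apply LinearMap.ext; intro y
  simp [wmul, e4, alph, v1, Pi.single_apply]

theorem mul_e1_e1 : wmul (e1 F) (e1 F) = ((-1 : F)) • e1 F := by
  simp only [e1, e2, e3, e4, wmul_sub_left, wmul_sub_right, wmul_add_left, wmul_add_right,
    wmul_smul_left, wmul_smul_right, wmul_alph, Fin.reduceEq, reduceIte, one_smul, zero_smul,
    smul_zero, sub_zero, zero_sub, smul_sub, smul_add, smul_smul, neg_neg, smul_neg, neg_zero,
    sub_self, add_zero, zero_add]
  try module

theorem mul_e1_e2 : wmul (e1 F) (e2 F) = ((-3 : F)) • e2 F := by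
  simp only [e1, e2, e3, e4, wmul_sub_left, wmul_sub_right, wmul_add_left, wmul_add_right,
    wmul_smul_left, wmul_smul_right, wmul_alph, Fin.reduceEq, reduceIte, one_smul, zero_smul,
    smul_zero, sub_zero, zero_sub, smul_sub, smul_add, smul_smul, neg_neg, smul_neg, neg_zero,
    sub_self, add_zero, zero_add]
  try module

theorem mul_e1_e3 : wmul (e1 F) (e3 F) = ((1 : F)) • e3 F := by
  simp only [e1, e2, e3, e4, wmul_sub_left, wmul_sub_right, wmul_add_left, wmul_add_right,
    wmul_smul_left, wmul_smul_right, wmul_alph, Fin.reduceEq, reduceIte, one_smul, zero_smul,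
    smul_zero, sub_zero, zero_sub, smul_sub, smul_add, smul_smul, neg_neg, smul_neg, neg_zero,
    sub_self, add_zero, zero_add]
  try module

theorem mul_e1_e4 : wmul (e1 F) (e4 F) = ((3 : F)) • e4 F := by
  simp only [e1, e2, e3, e4, wmul_sub_left, wmul_sub_right, wmul_add_left, wmul_add_right,
    wmul_smul_left, wmul_smul_right, wmul_alph, Fin.reduceEq, reduceIte, one_smul, zero_smul,
    smul_zero, sub_zero, zero_sub, smul_sub, smul_add, smul_smul, neg_neg, smul_neg, neg_zero,
    sub_self, add_zero, zero_add]
  try module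

theorem mul_e2_e1 : wmul (e2 F) (e1 F) = ((3 : F)) • e2 F := by
  simp only [e1, e2, e3, e4, wmul_sub_left, wmul_sub_right, wmul_add_left, wmul_add_right,
    wmul_smul_left, wmul_smul_right, wmul_alph, Fin.reduceEq, reduceIte, one_smul, zero_smul,
    smul_zero, sub_zero, zero_sub, smul_sub, smul_add, smul_smul, neg_neg, smul_neg, neg_zero,
    sub_self, add_zero, zero_add]
  try module

theorem mul_e2_e2 : wmul (e2 F) (e2 F) = 0 := by
  simp only [e1, e2, e3, e4, wmul_sub_left, wmul_sub_right, wmul_add_left, wmul_add_right,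
    wmul_smul_left, wmul_smul_right, wmul_alph, Fin.reduceEq, reduceIte, one_smul, zero_smul,
    smul_zero, sub_zero, zero_sub, smul_sub, smul_add, smul_smul, neg_neg, smul_neg, neg_zero,
    sub_self, add_zero, zero_add]
  try module

theorem mul_e2_e3 : wmul (e2 F) (e3 F) = ((2 : F)) • e1 F := by
  simp only [e1, e2, e3, e4, wmul_sub_left, wmul_sub_right, wmul_add_left, wmul_add_right,
    wmul_smul_left, wmul_smul_right, wmul_alph, Fin.reduceEq, reduceIte, one_smul, zero_smul,
    smul_zero, sub_zero, zero_sub, smul_sub, smul_add, smul_smul, neg_neg, smul_neg, neg_zero,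
    sub_self, add_zero, zero_add]
  try module

theorem mul_e2_e4 : wmul (e2 F) (e4 F) = ((1 : F)) • e3 F := by
  simp only [e1, e2, e3, e4, wmul_sub_left, wmul_sub_right, wmul_add_left, wmul_add_right,
    wmul_smul_left, wmul_smul_right, wmul_alph, Fin.reduceEq, reduceIte, one_smul, zero_smul,
    smul_zero, sub_zero, zero_sub, smul_sub, smul_add, smul_smul, neg_neg, smul_neg, neg_zero,
    sub_self, add_zero, zero_add]
  try module

theorem mul_e3_e1 : wmul (e3 F) (e1 F) = ((-2 : F)) • e3 F := by
  simp only [e1, e2, e3, e4, wmul_sub_left, wmul_sub_right, wmul_add_left, wmul_add_right,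
    wmul_smul_left, wmul_smul_right, wmul_alph, Fin.reduceEq, reduceIte, one_smul, zero_smul,
    smul_zero, sub_zero, zero_sub, smul_sub, smul_add, smul_smul, neg_neg, smul_neg, neg_zero,
    sub_self, add_zero, zero_add]
  try module

theorem mul_e3_e2 : wmul (e3 F) (e2 F) = ((-1 : F)) • e1 F := by
  simp only [e1, e2, e3, e4, wmul_sub_left, wmul_sub_right, wmul_add_left, wmul_add_right,
    wmul_smul_left, wmul_smul_right, wmul_alph, Fin.reduceEq, reduceIte, one_smul, zero_smul,
    smul_zero, sub_zero, zero_sub, smul_sub, smul_add, smul_smul, neg_neg, smul_neg, neg_zero,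
    sub_self, add_zero, zero_add]
  try module

theorem mul_e3_e3 : wmul (e3 F) (e3 F) = ((-3 : F)) • e4 F := by
  simp only [e1, e2, e3, e4, wmul_sub_left, wmul_sub_right, wmul_add_left, wmul_add_right,
    wmul_smul_left, wmul_smul_right, wmul_alph, Fin.reduceEq, reduceIte, one_smul, zero_smul,
    smul_zero, sub_zero, zero_sub, smul_sub, smul_add, smul_smul, neg_neg, smul_neg, neg_zero,
    sub_self, add_zero, zero_add]
  try module

theorem mul_e3_e4 : wmul (e3 F) (e4 F) = 0 := by
  simp only [e1, e2, e3, e4, wmul_sub_left, wmul_sub_right, wmul_add_left, wmul_add_right,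
    wmul_smul_left, wmul_smul_right, wmul_alph, Fin.reduceEq, reduceIte, one_smul, zero_smul,
    smul_zero, sub_zero, zero_sub, smul_sub, smul_add, smul_smul, neg_neg, smul_neg, neg_zero,
    sub_self, add_zero, zero_add]
  try module

/-- `S2` as a subspace of `W(2)`. -/
noncomputable def S2 (F : Type*) [Field F] : Submodule F (Wtwo F) :=
  Submodule.span F {e1 F, e2 F, e3 F, e4 F}

/-- The Kantor product, as a bilinear map. -/
noncomputable def wmulL (F : Type*) [Field F] : Wtwo F →ₗ[F] Wtwo F →ₗ[F] Wtwo F :=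
  LinearMap.mk₂ F wmul wmul_add_left wmul_smul_left wmul_add_right wmul_smul_right

theorem S2_mul_mem {x y : Wtwo F} (hx : x ∈ S2 F) (hy : y ∈ S2 F) :
    wmul x y ∈ S2 F := by
  have h2 : Submodule.map₂ (wmulL F) (S2 F) (S2 F) ≤ S2 F := by
    rw [S2, Submodule.map₂_span_span, Submodule.span_le]
    rintro z ⟨a, ha, b, hb, rfl⟩
    simp only [Set.mem_insert_iff, Set.mem_singleton_iff] at ha hb
    rcases ha with rfl | rfl | rfl | rfl <;> rcases hb with rfl | rfl | rfl | rfl <;>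
      simp only [wmulL, LinearMap.mk₂_apply, mul_e1_e1, mul_e1_e2, mul_e1_e3, mul_e1_e4, mul_e2_e1, mul_e2_e2, mul_e2_e3, mul_e2_e4, mul_e3_e1, mul_e3_e2, mul_e3_e3, mul_e3_e4, mul_e4_left] <;>
      first
        | exact Submodule.zero_mem _
        | exact Submodule.smul_mem _ _ (Submodule.subset_span (by simp))
        | exact Submodule.subset_span (by simp)
  exact h2 (Submodule.apply_mem_map₂ _ hx hy)

/-- The product on `S2` (the Kantor product, which leaves `S2` invariant). -/
noncomputable def S2mul (x y : S2 F) : S2 F :=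
  ⟨wmul x y, S2_mul_mem x.2 y.2⟩

/-- An automorphism of the algebra `S2`. -/
def IsAutomorphismS2 (φ : S2 F →ₗ[F] S2 F) : Prop :=
  Function.Bijective φ ∧ ∀ x y : S2 F, φ (S2mul x y) = S2mul (φ x) (φ y)

/-- The element of `W(2)` with coordinates `a, b, c, d` with respect to `e₁, e₂, e₃, e₄`. -/
noncomputable def S2comb (a b c d : F) : Wtwo F := a • e1 F + b • e2 F + c • e3 F + d • e4 F

theorem S2comb_mem (a b c d : F) : S2comb a b c d ∈ S2 F :=
  add_mem (add_mem (add_mem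
    (Submodule.smul_mem _ _ (Submodule.subset_span (by simp)))
    (Submodule.smul_mem _ _ (Submodule.subset_span (by simp))))
    (Submodule.smul_mem _ _ (Submodule.subset_span (by simp))))
    (Submodule.smul_mem _ _ (Submodule.subset_span (by simp)))

theorem S2comb_inj {a b c d a' b' c' d' : F} :
    S2comb a b c d = S2comb a' b' c' d' ↔ a = a' ∧ b = b' ∧ c = c' ∧ d = d' := by
  refine ⟨fun h => ?_, by rintro ⟨rfl, rfl, rfl, rfl⟩; rfl⟩
  have coord (i j k : Fin 2) :=
    congrFun (LinearMap.congr_fun (LinearMap.congr_fun h (Pi.single i 1)) (Pi.single j 1)) k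
  have h1 := coord 0 0 0
  have h2 := coord 0 0 1
  have h3 := coord 1 1 1
  have h4 := coord 1 1 0
  simp [S2comb, e1, e2, e3, e4, alph] at h1 h2 h3 h4
  exact ⟨h1, h2, h3, h4⟩

theorem wmul_S2comb (a b c d a' b' c' d' : F) :
    wmul (S2comb a b c d) (S2comb a' b' c' d') =
      S2comb (-(a * a') + 2 * b * c' - c * b') (3 * b * a' - 3 * a * b')
        (a * c' + b * d' - 2 * c * a') (3 * a * d' - 3 * c * c') := by
  simp only [S2comb, wmul_add_left, wmul_add_right, wmul_smul_left, wmul_smul_right,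
    mul_e1_e1, mul_e1_e2, mul_e1_e3, mul_e1_e4, mul_e2_e1, mul_e2_e2, mul_e2_e3, mul_e2_e4,
    mul_e3_e1, mul_e3_e2, mul_e3_e3, mul_e3_e4, mul_e4_left]
  module

/-- The element of `S2` with coordinates `a, b, c, d` with respect to `e₁, e₂, e₃, e₄`. -/
noncomputable def S2mk (a b c d : F) : S2 F := ⟨S2comb a b c d, S2comb_mem a b c d⟩

theorem S2mk_inj {a b c d a' b' c' d' : F} :
    S2mk a b c d = S2mk a' b' c' d' ↔ a = a' ∧ b = b' ∧ c = c' ∧ d = d' := by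
  rw [S2mk, S2mk, Subtype.mk.injEq, S2comb_inj]

theorem exists_eq_S2mk (x : S2 F) : ∃ a b c d : F, x = S2mk a b c d := by
  obtain ⟨x, hx⟩ := x
  simp only [S2, Submodule.mem_span_insert, Submodule.mem_span_singleton] at hx
  obtain ⟨a, y, ⟨b, z, ⟨c, w, ⟨d, hw⟩, hz⟩, hy⟩, hx⟩ := hx
  refine ⟨a, b, c, d, Subtype.ext ?_⟩
  simp only [S2mk, S2comb, hx, hy, hz, ← hw, add_assoc]

theorem S2mul_S2mk (a b c d a' b' c' d' : F) :
    S2mul (S2mk a b c d) (S2mk a' b' c' d') =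
      S2mk (-(a * a') + 2 * b * c' - c * b') (3 * b * a' - 3 * a * b')
        (a * c' + b * d' - 2 * c * a') (3 * a * d' - 3 * c * c') :=
  Subtype.ext (wmul_S2comb a b c d a' b' c' d')

theorem S2mk_eq (a b c d : F) : S2mk a b c d =
    a • S2mk 1 0 0 0 + b • S2mk 0 1 0 0 + c • S2mk 0 0 1 0 + d • S2mk 0 0 0 1 := by
  apply Subtype.ext
  simp [S2mk, S2comb]

theorem smul_S2mk (t a b c d : F) :
    t • S2mk a b c d = S2mk (t * a) (t * b) (t * c) (t * d) := by
  apply Subtype.ext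
  simp only [S2mk, S2comb, SetLike.mk_smul_mk]
  module

/-- A multiplicative linear endomorphism of `S2` that fixes `e₂` is the identity. -/
theorem S2_eq_id_of_map_e2 [CharZero F] {χ : S2 F →ₗ[F] S2 F}
    (hmul : ∀ x y : S2 F, χ (S2mul x y) = S2mul (χ x) (χ y))
    (h2 : χ (S2mk 0 1 0 0) = S2mk 0 1 0 0) : χ = LinearMap.id := by
  have h1 : χ (S2mk 1 0 0 0) = S2mk 1 0 0 0 := by
    obtain ⟨a, b, c, d, h⟩ := exists_eq_S2mk (χ (S2mk 1 0 0 0))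
    have h21 := hmul (S2mk 0 1 0 0) (S2mk 1 0 0 0)
    have h11 := hmul (S2mk 1 0 0 0) (S2mk 1 0 0 0)
    rw [S2mul_S2mk, show S2mk _ _ _ _ = (3 : F) • S2mk (0 : F) 1 0 0 by
      rw [smul_S2mk, S2mk_inj]; norm_num, map_smul, h2, h, smul_S2mk, S2mul_S2mk, S2mk_inj] at h21
    rw [S2mul_S2mk, show S2mk _ _ _ _ = (-1 : F) • S2mk (1 : F) 0 0 0 by
      rw [smul_S2mk, S2mk_inj]; norm_num, map_smul, h, smul_S2mk, S2mul_S2mk, S2mk_inj] at h11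
    rw [h, S2mk_inj]
    grind
  have h3 : χ (S2mk 0 0 1 0) = S2mk 0 0 1 0 := by
    obtain ⟨a, b, c, d, h⟩ := exists_eq_S2mk (χ (S2mk 0 0 1 0))
    have h23 := hmul (S2mk 0 1 0 0) (S2mk 0 0 1 0)
    have h13 := hmul (S2mk 1 0 0 0) (S2mk 0 0 1 0)
    rw [S2mul_S2mk, show S2mk _ _ _ _ = (2 : F) • S2mk (1 : F) 0 0 0 by
      rw [smul_S2mk, S2mk_inj]; norm_num, map_smul, h1, h2, h, smul_S2mk, S2mul_S2mk,
      S2mk_inj] at h23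
    rw [S2mul_S2mk, show S2mk _ _ _ _ = S2mk (0 : F) 0 1 0 by
      rw [S2mk_inj]; norm_num, h1, h, S2mul_S2mk, S2mk_inj] at h13
    rw [h, S2mk_inj]
    grind
  have h4 : χ (S2mk 0 0 0 1) = S2mk 0 0 0 1 := by
    have h33 := hmul (S2mk 0 0 1 0) (S2mk 0 0 1 0)
    rw [h3, S2mul_S2mk, show S2mk _ _ _ _ = (-3 : F) • S2mk (0 : F) 0 0 1 by
      rw [smul_S2mk, S2mk_inj]; norm_num, map_smul] at h33
    exact smul_right_injective _ (by norm_num : (-3 : F) ≠ 0) h33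
  ext1 x
  obtain ⟨a, b, c, d, rfl⟩ := exists_eq_S2mk x
  rw [S2mk_eq]
  simp only [map_add, map_smul, h1, h2, h3, h4, LinearMap.id_apply]

/-- An automorphism of `S2` is determined by its value at `e₂`. -/
theorem IsAutomorphismS2.eq_of_map_e2_eq [CharZero F] {φ ψ : S2 F →ₗ[F] S2 F}
    (hφ : IsAutomorphismS2 φ) (hψ : IsAutomorphismS2 ψ)
    (h : φ (S2mk 0 1 0 0) = ψ (S2mk 0 1 0 0)) : φ = ψ := by
  let e := LinearEquiv.ofBijective ψ hψ.1
  have he (x : S2 F) : ψ (e.symm x) = x := e.apply_symm_apply x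
  have hχ : e.symm.toLinearMap ∘ₗ φ = LinearMap.id := by
    apply S2_eq_id_of_map_e2
    · intro x y
      apply hψ.1.injective
      simp [hψ.2, he, hφ.2]
    · apply hψ.1.injective
      simp [he, h]
  ext1 x
  rw [← he (φ x)]
  exact congrArg ψ (LinearMap.congr_fun hχ x)

/-- Every 2-local automorphism of the algebra `S2` is an automorphism
(in particular, it is linear and bijective). -/
theorem every_twoLocalAutomorphism_isAutomorphism_S2 {F : Type*} [Field F] [CharZero F]
    (Δ : S2 F → S2 F)
    (hΔ : ∀ x y : S2 F, ∃ φ : S2 F →ₗ[F] S2 F,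
      IsAutomorphismS2 φ ∧ Δ x = φ x ∧ Δ y = φ y) :
    ∃ φ : S2 F →ₗ[F] S2 F, IsAutomorphismS2 φ ∧ ∀ z : S2 F, Δ z = φ z := by
  obtain ⟨φ, hφ, hφ2, -⟩ := hΔ (S2mk 0 1 0 0) (S2mk 0 1 0 0)
  refine ⟨φ, hφ, fun z => ?_⟩
  obtain ⟨ψ, hψ, hψ2, hz⟩ := hΔ (S2mk 0 1 0 0) z
  rw [hz, hφ.eq_of_map_e2_eq hψ (hφ2.symm.trans hψ2)]
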